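/- Let A₁, A₂, A₃, A₄ be pairwise transverse affine parabolic spaces in 𝔰𝔩ₙ(ℝ) and let (g,Y) ∈ SLₙ(ℝ) ⋉ 𝔰𝔩ₙ(ℝ). Then the images (g,Y)·A₁, …, (g,Y)·A₄ are again pairwise transverse affine parabolic spaces and β((g,Y)·A₁, (g,Y)·A₂, (g,Y)·A₃, (g,Y)·A₄) = β(A₁, A₂, A₃, A₄). -/

import Mathlib

open Matrix

noncomputable section

abbrev Mn (n : ℕ) := Matrix (Fin n) (Fin n) ℝ

/-- Conjugation `Z ↦ g Z g⁻¹` as a linear map on matrices. -/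
def AdM {n : ℕ} (g : Mn n) : Mn n →ₗ[ℝ] Mn n where
  toFun Z := g * Z * g⁻¹
  map_add' X Y := by simp [Matrix.add_mul, Matrix.mul_add]
  map_smul' c X := by simp [Matrix.smul_mul, Matrix.mul_smul]

/-- Projection onto the diagonal part. -/
def pi0 {n : ℕ} : Mn n →ₗ[ℝ] Mn n where
  toFun Z := Matrix.diagonal (fun i => Z i i)
  map_add' X Y := by
    ext i j
    by_cases h : i = j <;> simp [Matrix.diagonal_apply, h]
  map_smul' c X := by
    ext i j
    by_cases h : i = j <;> simp [Matrix.diagonal_apply, h]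

/-- The involution reversing the diagonal entries (on diagonal matrices). -/
def omega0 {n : ℕ} : Mn n →ₗ[ℝ] Mn n where
  toFun Z := Matrix.diagonal (fun i => Z i.rev i.rev)
  map_add' X Y := by
    ext i j
    by_cases h : i = j <;> simp [Matrix.diagonal_apply, h]
  map_smul' c X := by
    ext i j
    by_cases h : i = j <;> simp [Matrix.diagonal_apply, h]

/-- Traceless matrices: 𝔰𝔩ₙ(ℝ). -/
def slSub (n : ℕ) : Submodule ℝ (Mn n) := LinearMap.ker (Matrix.traceLinearMap (Fin n) ℝ ℝ)

/-- Matrices vanishing below the diagonal (upper triangular). -/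
def upTri (n : ℕ) : Submodule ℝ (Mn n) where
  carrier := {Z | ∀ i j : Fin n, j < i → Z i j = 0}
  add_mem' := by intro a b ha hb i j h; simp [Matrix.add_apply, ha i j h, hb i j h]
  zero_mem' := by intro i j h; rfl
  smul_mem' := by intro c a ha i j h; simp [Matrix.smul_apply, ha i j h]

/-- Matrices vanishing above the diagonal (lower triangular). -/
def loTri (n : ℕ) : Submodule ℝ (Mn n) where
  carrier := {Z | ∀ i j : Fin n, i < j → Z i j = 0}
  add_mem' := by intro a b ha hb i j h; simp [Matrix.add_apply, ha i j h, hb i j h]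
  zero_mem' := by intro i j h; rfl
  smul_mem' := by intro c a ha i j h; simp [Matrix.smul_apply, ha i j h]

/-- Diagonal matrices. -/
def diagSub (n : ℕ) : Submodule ℝ (Mn n) where
  carrier := {Z | ∀ i j : Fin n, i ≠ j → Z i j = 0}
  add_mem' := by intro a b ha hb i j h; simp [Matrix.add_apply, ha i j h, hb i j h]
  zero_mem' := by intro i j h; rfl
  smul_mem' := by intro c a ha i j h; simp [Matrix.smul_apply, ha i j h]

/-- Strictly upper triangular matrices: 𝔫⁺. -/
def nplus (n : ℕ) : Submodule ℝ (Mn n) where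
  carrier := {Z | ∀ i j : Fin n, j ≤ i → Z i j = 0}
  add_mem' := by intro a b ha hb i j h; simp [Matrix.add_apply, ha i j h, hb i j h]
  zero_mem' := by intro i j h; rfl
  smul_mem' := by intro c a ha i j h; simp [Matrix.smul_apply, ha i j h]

/-- Strictly lower triangular matrices: 𝔫⁻. -/
def nminus (n : ℕ) : Submodule ℝ (Mn n) where
  carrier := {Z | ∀ i j : Fin n, i ≤ j → Z i j = 0}
  add_mem' := by intro a b ha hb i j h; simp [Matrix.add_apply, ha i j h, hb i j h]
  zero_mem' := by intro i j h; rfl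
  smul_mem' := by intro c a ha i j h; simp [Matrix.smul_apply, ha i j h]

/-- 𝔟⁺ : traceless upper triangular matrices. -/
def bplus (n : ℕ) : Submodule ℝ (Mn n) := slSub n ⊓ upTri n

/-- 𝔟⁻ : traceless lower triangular matrices. -/
def bminus (n : ℕ) : Submodule ℝ (Mn n) := slSub n ⊓ loTri n

/-- 𝔞 : traceless diagonal matrices. -/
def aSub (n : ℕ) : Submodule ℝ (Mn n) := slSub n ⊓ diagSub n

/-- A parabolic subspace of 𝔰𝔩ₙ(ℝ): a subspace of the form Ad(g)𝔟⁺ with g ∈ SLₙ(ℝ). -/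
def IsParabolic {n : ℕ} (V : Submodule ℝ (Mn n)) : Prop :=
  ∃ g : Mn n, g.det = 1 ∧ V = (bplus n).map (AdM g)

/-- Two subspaces are transverse if together they span 𝔰𝔩ₙ(ℝ). -/
def Transv {n : ℕ} (V W : Submodule ℝ (Mn n)) : Prop := V ⊔ W = slSub n

/-- A standardizer of an ordered transverse pair of parabolic subspaces. -/
def IsStd {n : ℕ} (h : Mn n) (V₁ V₂ : Submodule ℝ (Mn n)) : Prop :=
  h.det = 1 ∧ (bplus n).map (AdM h) = V₁ ∧ (bminus n).map (AdM h) = V₂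

/-- ν*_{i,j} computed with the standardizer h. -/
def nustar {n : ℕ} (h : Mn n) : Mn n →ₗ[ℝ] Mn n := pi0 ∘ₗ AdM h⁻¹

/-- ν_{i,j} computed with the standardizer h. -/
def nuMap {n : ℕ} (h : Mn n) : Mn n →ₗ[ℝ] Mn n := AdM h ∘ₗ pi0

/-- π_{i,j} computed with the standardizer h. -/
def piStd {n : ℕ} (h : Mn n) : Mn n →ₗ[ℝ] Mn n := AdM h ∘ₗ pi0 ∘ₗ AdM h⁻¹

/-- The commutator subspace [V,V]. -/
def commSub {n : ℕ} (V : Submodule ℝ (Mn n)) : Submodule ℝ (Mn n) :=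
  Submodule.span ℝ {z | ∃ x ∈ V, ∃ y ∈ V, z = x * y - y * x}

/-- An affine parabolic space with direction V: an affine subspace X + V of 𝔰𝔩ₙ(ℝ)
whose direction V is a parabolic subspace. -/
def IsAffPara {n : ℕ} (A : Set (Mn n)) (V : Submodule ℝ (Mn n)) : Prop :=
  IsParabolic V ∧ ∃ X : Mn n, X ∈ slSub n ∧ A = {Z | Z - X ∈ V}

/-- `IsCross b A₁ A₂ A₃ A₄ V₁ V₂ V₃ V₄` : b is a value of the affine cross ratio
β(A₁,A₂,A₃,A₄), computed with some choice of standardizers and intersection points. -/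
def IsCross {n : ℕ} (b : Mn n) (A₁ A₂ A₃ A₄ : Set (Mn n))
    (V₁ V₂ V₃ V₄ : Submodule ℝ (Mn n)) : Prop :=
  ∃ h₁₄ h₂₃ : Mn n, ∃ X₁₃ X₂₄ : Mn n,
    IsStd h₁₄ V₁ V₄ ∧ IsStd h₂₃ V₂ V₃ ∧ X₁₃ ∈ A₁ ∩ A₃ ∧ X₂₄ ∈ A₂ ∩ A₄ ∧
    b = nustar h₁₄ (X₁₃ - X₂₄) - nustar h₂₃ (X₁₃ - X₂₄)

/-- `IsTriple d A₂ A₃ A₄ V₂ V₃ V₄` : d is a value of the affine triple ratio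
δ(A₂,A₃,A₄), computed with some choice of standardizers and points. -/
def IsTriple {n : ℕ} (d : Mn n) (A₂ A₃ A₄ : Set (Mn n))
    (V₂ V₃ V₄ : Submodule ℝ (Mn n)) : Prop :=
  ∃ h₂₃ h₃₂ h₃₄ h₄₃ h₄₂ h₂₄ : Mn n, ∃ X₂ X₃ X₄ : Mn n,
    IsStd h₂₃ V₂ V₃ ∧ IsStd h₃₂ V₃ V₂ ∧ IsStd h₃₄ V₃ V₄ ∧ IsStd h₄₃ V₄ V₃ ∧
    IsStd h₄₂ V₄ V₂ ∧ IsStd h₂₄ V₂ V₄ ∧ X₂ ∈ A₂ ∧ X₃ ∈ A₃ ∧ X₄ ∈ A₄ ∧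
    d = (nustar h₂₃ (X₂ - X₃) + nustar h₃₂ (X₂ - X₃))
      + (nustar h₃₄ (X₃ - X₄) + nustar h₄₃ (X₃ - X₄))
      + (nustar h₄₂ (X₄ - X₂) + nustar h₂₄ (X₄ - X₂))

/-- The affine action of (g,Y) ∈ SLₙ(ℝ) ⋉ 𝔰𝔩ₙ(ℝ) on 𝔰𝔩ₙ(ℝ). -/
def affMap {n : ℕ} (g Y : Mn n) : Mn n → Mn n := fun Z => g * Z * g⁻¹ + Y

section

variable {n : ℕ}

theorem isUnit_det_of_det_eq_one {g : Mn n} (hg : g.det = 1) : IsUnit g.det := by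
  rw [hg]; exact isUnit_one

theorem AdM_apply (g Z : Mn n) : AdM g Z = g * Z * g⁻¹ := rfl

theorem AdM_mul (g h : Mn n) : AdM (g * h) = AdM g ∘ₗ AdM h := by
  ext1 Z
  simp only [LinearMap.comp_apply, AdM_apply, Matrix.mul_inv_rev, Matrix.mul_assoc]

theorem AdM_inv_AdM {g : Mn n} (hg : g.det = 1) (Z : Mn n) : AdM g⁻¹ (AdM g Z) = Z := by
  have hu := isUnit_det_of_det_eq_one hg
  simp only [AdM_apply, Matrix.nonsing_inv_nonsing_inv _ hu, Matrix.mul_assoc,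
    Matrix.nonsing_inv_mul _ hu, Matrix.mul_one, Matrix.nonsing_inv_mul_cancel_left _ _ hu]

theorem AdM_AdM_inv {g : Mn n} (hg : g.det = 1) (Z : Mn n) : AdM g (AdM g⁻¹ Z) = Z := by
  have hu := isUnit_det_of_det_eq_one hg
  simp only [AdM_apply, Matrix.nonsing_inv_nonsing_inv _ hu, Matrix.mul_assoc,
    Matrix.mul_nonsing_inv _ hu, Matrix.mul_one, Matrix.mul_nonsing_inv_cancel_left _ _ hu]

theorem det_inv_eq_one {g : Mn n} (hg : g.det = 1) : g⁻¹.det = 1 := by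
  rw [Matrix.det_nonsing_inv, hg, Ring.inverse_one]

theorem mem_slSub {Z : Mn n} : Z ∈ slSub n ↔ Z.trace = 0 := Iff.rfl

theorem AdM_mem_slSub {g Z : Mn n} (hg : g.det = 1) (hZ : Z ∈ slSub n) : AdM g Z ∈ slSub n := by
  rw [mem_slSub] at hZ ⊢
  rw [AdM_apply, Matrix.trace_mul_comm,
    Matrix.nonsing_inv_mul_cancel_left _ _ (isUnit_det_of_det_eq_one hg), hZ]

theorem map_AdM_slSub {g : Mn n} (hg : g.det = 1) : (slSub n).map (AdM g) = slSub n := by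
  apply le_antisymm
  · rintro _ ⟨Z, hZ, rfl⟩
    exact AdM_mem_slSub hg hZ
  · intro Z hZ
    exact ⟨AdM g⁻¹ Z, AdM_mem_slSub (det_inv_eq_one hg) hZ, AdM_AdM_inv hg Z⟩

theorem Transv.map_AdM {V W : Submodule ℝ (Mn n)} (h : Transv V W) {g : Mn n} (hg : g.det = 1) :
    Transv (V.map (AdM g)) (W.map (AdM g)) := by
  unfold Transv at h ⊢
  rw [← Submodule.map_sup, h, map_AdM_slSub hg]

theorem affMap_eq (g Y Z : Mn n) : affMap g Y Z = AdM g Z + Y := rfl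

theorem IsParabolic.map_AdM {V : Submodule ℝ (Mn n)} (h : IsParabolic V) {g : Mn n}
    (hg : g.det = 1) : IsParabolic (V.map (AdM g)) := by
  obtain ⟨k, hk, rfl⟩ := h
  exact ⟨g * k, by rw [Matrix.det_mul, hg, hk, one_mul], by rw [AdM_mul, Submodule.map_comp]⟩

theorem IsAffPara.image_affMap {A : Set (Mn n)} {V : Submodule ℝ (Mn n)} (h : IsAffPara A V)
    {g Y : Mn n} (hg : g.det = 1) (hY : Y.trace = 0) :
    IsAffPara (affMap g Y '' A) (V.map (AdM g)) := by
  obtain ⟨hV, X, hX, rfl⟩ := h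
  refine ⟨hV.map_AdM hg, affMap g Y X,
    add_mem (AdM_mem_slSub hg hX) (mem_slSub.2 hY), ?_⟩
  ext Z
  constructor
  · rintro ⟨W, hW, rfl⟩
    exact ⟨W - X, hW, by rw [affMap_eq, affMap_eq, map_sub, add_sub_add_right_eq_sub]⟩
  · rintro ⟨W, hW, hWZ⟩
    refine ⟨W + X, by simpa using hW, ?_⟩
    rw [affMap_eq, map_add, hWZ, affMap_eq]
    abel

theorem IsAffPara.sub_mem {A : Set (Mn n)} {V : Submodule ℝ (Mn n)} (h : IsAffPara A V)
    {X Y : Mn n} (hX : X ∈ A) (hY : Y ∈ A) : X - Y ∈ V := by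
  obtain ⟨-, P, -, rfl⟩ := h
  simpa using V.sub_mem hX hY

theorem IsStd.mul_left {h : Mn n} {V W : Submodule ℝ (Mn n)} (hs : IsStd h V W) {g : Mn n}
    (hg : g.det = 1) : IsStd (g * h) (V.map (AdM g)) (W.map (AdM g)) := by
  obtain ⟨hd, rfl, rfl⟩ := hs
  exact ⟨by rw [Matrix.det_mul, hg, hd, one_mul], by rw [AdM_mul, Submodule.map_comp],
    by rw [AdM_mul, Submodule.map_comp]⟩

theorem nustar_mul_AdM {g : Mn n} (hg : g.det = 1) (h Z : Mn n) :
    nustar (g * h) (AdM g Z) = nustar h Z := by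
  rw [nustar, nustar, Matrix.mul_inv_rev, AdM_mul, LinearMap.comp_apply, LinearMap.comp_apply,
    LinearMap.comp_apply, AdM_inv_AdM hg]

theorem IsCross.image_affMap {b : Mn n} {A₁ A₂ A₃ A₄ : Set (Mn n)}
    {V₁ V₂ V₃ V₄ : Submodule ℝ (Mn n)} (hb : IsCross b A₁ A₂ A₃ A₄ V₁ V₂ V₃ V₄)
    {g : Mn n} (hg : g.det = 1) (Y : Mn n) :
    IsCross b (affMap g Y '' A₁) (affMap g Y '' A₂) (affMap g Y '' A₃) (affMap g Y '' A₄)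
      (V₁.map (AdM g)) (V₂.map (AdM g)) (V₃.map (AdM g)) (V₄.map (AdM g)) := by
  obtain ⟨h, m, X, Z, hh, hm, hX, hZ, rfl⟩ := hb
  refine ⟨g * h, g * m, affMap g Y X, affMap g Y Z, hh.mul_left hg, hm.mul_left hg,
    ⟨⟨X, hX.1, rfl⟩, ⟨X, hX.2, rfl⟩⟩, ⟨⟨Z, hZ.1, rfl⟩, ⟨Z, hZ.2, rfl⟩⟩, ?_⟩
  rw [affMap_eq, affMap_eq, add_sub_add_right_eq_sub, ← map_sub, nustar_mul_AdM hg,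
    nustar_mul_AdM hg]

theorem upTri_mul_diag {A B : Mn n} (hA : A ∈ upTri n) (hB : B ∈ upTri n) (i : Fin n) :
    (A * B) i i = A i i * B i i := by
  rw [Matrix.mul_apply]
  refine Finset.sum_eq_single i (fun l _ hl => ?_) (by simp)
  rcases lt_or_gt_of_ne hl with h | h
  · rw [hA i l h, zero_mul]
  · rw [hB l i h, mul_zero]

/-- The normalizer of `𝔟⁺` consists of upper triangular matrices. -/
theorem mem_upTri_of_AdM_bplus {k : Mn n} (hk : k.det = 1)
    (h : ∀ Z ∈ bplus n, AdM k Z ∈ bplus n) : k ∈ upTri n := by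
  have hu := isUnit_det_of_det_eq_one hk
  intro i
  induction i using WellFoundedGT.induction with
  | ind i ih =>
  intro a hai
  set E : Mn n := Matrix.single a i 1 with hE
  set D : Mn n := Matrix.single a a 1 - Matrix.single i i 1 with hD
  have hEb : E ∈ bplus n := by
    refine ⟨mem_slSub.2 (Matrix.trace_single_eq_of_ne _ _ _ hai.ne), fun p q hpq => ?_⟩
    rw [hE, Matrix.single_apply]
    split_ifs with hc
    · obtain ⟨rfl, rfl⟩ := hc
      exact absurd hpq hai.not_gt
    · rfl
  have hDb : D ∈ bplus n := by
    refine ⟨mem_slSub.2 (by simp [hD, Matrix.trace_sub]), fun p q hpq => ?_⟩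
    have h1 : ¬ (a = p ∧ a = q) := by rintro ⟨rfl, h'⟩; exact hpq.ne' h'
    have h2 : ¬ (i = p ∧ i = q) := by rintro ⟨rfl, h'⟩; exact hpq.ne' h'
    rw [hD, Matrix.sub_apply, Matrix.single_apply, Matrix.single_apply, if_neg h1, if_neg h2,
      sub_zero]
  have hcomm : D * E - E * D = (2 : ℝ) • E := by
    have hne : i ≠ a := hai.ne'
    simp only [hD, hE, Matrix.sub_mul, Matrix.mul_sub, Matrix.single_mul_single_same,
      Matrix.single_mul_single_of_ne _ _ _ _ hne]
    rw [two_smul]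
    simp
  have hU := (h E hEb).2
  have hW := (h D hDb).2
  have hAd : ∀ X Z : Mn n, AdM k (X * Z) = AdM k X * AdM k Z := by
    intro X Z
    simp only [AdM_apply, Matrix.mul_assoc, Matrix.nonsing_inv_mul_cancel_left _ _ hu]
  have hUi : AdM k E i i = 0 := by
    have h2 := congrArg (fun M : Mn n => AdM k M i i) hcomm
    simp only [map_sub, map_smul, hAd, Matrix.sub_apply, Matrix.smul_apply, smul_eq_mul,
      upTri_mul_diag hU hW, upTri_mul_diag hW hU] at h2
    linarith
  have hkE : k * E = AdM k E * k := by
    rw [AdM_apply, Matrix.mul_assoc, Matrix.nonsing_inv_mul _ hu, Matrix.mul_one]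
  have hent := congrFun (congrFun hkE i) i
  rw [hE, Matrix.mul_single_apply_same, mul_one, Matrix.mul_apply] at hent
  rw [hent]
  refine Finset.sum_eq_zero fun l _ => ?_
  rcases lt_trichotomy l i with hl | rfl | hl
  · rw [hU i l hl, zero_mul]
  · rw [hUi, zero_mul]
  · rw [ih l hl i hl, mul_zero]

theorem transpose_mem_bminus {Z : Mn n} (hZ : Z ∈ bplus n) : Zᵀ ∈ bminus n :=
  ⟨mem_slSub.2 (by rw [Matrix.trace_transpose]; exact hZ.1), fun i j hij => hZ.2 j i hij⟩

theorem transpose_mem_bplus {Z : Mn n} (hZ : Z ∈ bminus n) : Zᵀ ∈ bplus n :=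
  ⟨mem_slSub.2 (by rw [Matrix.trace_transpose]; exact hZ.1), fun i j hij => hZ.2 j i hij⟩

/-- The normalizer of `𝔟⁻` consists of lower triangular matrices. -/
theorem mem_loTri_of_AdM_inv_bminus {k : Mn n} (hk : k.det = 1)
    (h : ∀ Z ∈ bminus n, AdM k⁻¹ Z ∈ bminus n) : k ∈ loTri n := by
  have hu := isUnit_det_of_det_eq_one hk
  have hT : kᵀ ∈ upTri n := by
    refine mem_upTri_of_AdM_bplus (by rw [Matrix.det_transpose, hk]) fun Z hZ => ?_
    have h1 := transpose_mem_bplus (h _ (transpose_mem_bminus hZ))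
    rwa [AdM_apply, Matrix.nonsing_inv_nonsing_inv _ hu, Matrix.transpose_mul,
      Matrix.transpose_mul, Matrix.transpose_transpose, Matrix.transpose_nonsing_inv,
      ← Matrix.mul_assoc] at h1
  exact fun i j hij => hT j i hij

theorem pi0_AdM_inv_of_diag {k : Mn n} (hk : k.det = 1) (hup : k ∈ upTri n) (hlo : k ∈ loTri n)
    (Z : Mn n) : pi0 (AdM k⁻¹ Z) = pi0 Z := by
  have hu := isUnit_det_of_det_eq_one hk
  have hd : k = Matrix.diagonal (fun i => k i i) := by
    ext i j
    rcases lt_trichotomy i j with h | rfl | h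
    · rw [hlo i j h, Matrix.diagonal_apply_ne _ h.ne]
    · rw [Matrix.diagonal_apply_eq]
    · rw [hup i j h, Matrix.diagonal_apply_ne _ h.ne']
  have hne : ∀ i, k i i ≠ 0 := by
    have h1 : ∏ i, k i i = 1 := by rw [← Matrix.det_diagonal, ← hd, hk]
    exact fun i => Finset.prod_ne_zero_iff.1 (ne_of_eq_of_ne h1 one_ne_zero) i (Finset.mem_univ i)
  have heq : k * AdM k⁻¹ Z = Z * k := by
    rw [AdM_apply, Matrix.nonsing_inv_nonsing_inv _ hu, Matrix.mul_assoc,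
      Matrix.mul_nonsing_inv_cancel_left _ _ hu]
  change Matrix.diagonal _ = Matrix.diagonal _
  congr 1
  funext i
  have h2 := congrFun (congrFun heq i) i
  generalize AdM k⁻¹ Z = W at h2 ⊢
  rw [hd, Matrix.diagonal_mul, Matrix.mul_diagonal, mul_comm] at h2
  exact mul_right_cancel₀ (hne i) h2

theorem AdM_inv_mul_mem {h h' : Mn n} (hh : h.det = 1) {B : Submodule ℝ (Mn n)}
    (hB : B.map (AdM h) = B.map (AdM h')) {Z : Mn n} (hZ : Z ∈ B) : AdM (h⁻¹ * h') Z ∈ B := by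
  have h1 : AdM h' Z ∈ B.map (AdM h) := hB ▸ ⟨Z, hZ, rfl⟩
  obtain ⟨W, hW, hWZ⟩ := h1
  rwa [AdM_mul, LinearMap.comp_apply, ← hWZ, AdM_inv_AdM hh]

/-- `ν*` does not depend on the choice of standardizer. -/
theorem IsStd.nustar_eq {h h' : Mn n} {V W : Submodule ℝ (Mn n)} (hs : IsStd h V W)
    (hs' : IsStd h' V W) : nustar h = nustar h' := by
  have hu := isUnit_det_of_det_eq_one hs.1
  have hk : (h⁻¹ * h').det = 1 := by rw [Matrix.det_mul, det_inv_eq_one hs.1, hs'.1, one_mul]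
  have hup : h⁻¹ * h' ∈ upTri n := mem_upTri_of_AdM_bplus hk fun Z hZ =>
    AdM_inv_mul_mem hs.1 (hs.2.1.trans hs'.2.1.symm) hZ
  have hlo : h⁻¹ * h' ∈ loTri n := mem_loTri_of_AdM_inv_bminus hk fun Z hZ => by
    rw [Matrix.mul_inv_rev, Matrix.nonsing_inv_nonsing_inv _ hu]
    exact AdM_inv_mul_mem hs'.1 (hs'.2.2.trans hs.2.2.symm) hZ
  ext1 Z
  have hZ := pi0_AdM_inv_of_diag hk hup hlo (AdM h⁻¹ Z)
  rw [Matrix.mul_inv_rev, Matrix.nonsing_inv_nonsing_inv _ hu, AdM_mul, LinearMap.comp_apply,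
    AdM_AdM_inv hs.1] at hZ
  exact hZ.symm

/-- If `𝔟⁺` and `Ad(k)𝔟⁻` are transverse, then all trailing principal minors of `k` are nonzero. -/
theorem det_toBlock_ne_zero {k : Mn n} (hk : k.det = 1)
    (ht : Transv (bplus n) ((bminus n).map (AdM k))) (p : Fin n → Prop) [DecidablePred p]
    (hp : ∀ i j, i ≤ j → p i → p j) : (k.toBlock p p).det ≠ 0 := by
  intro h0
  have hu := isUnit_det_of_det_eq_one hk
  obtain ⟨w₀, hw₀, hkw₀⟩ := Matrix.exists_mulVec_eq_zero_iff.2 h0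
  obtain ⟨v₀, hv₀, hvk₀⟩ := Matrix.exists_vecMul_eq_zero_iff.2 h0
  have sum_ext : ∀ (x : {j // p j} → ℝ) (f : Fin n → ℝ),
      ∑ j, f j * (if h : p j then x ⟨j, h⟩ else 0) = ∑ j : {j // p j}, f j * x j := by
    intro x f
    rw [← Fintype.sum_subtype_add_sum_subtype p]
    have h2 : ∑ j : {j // ¬ p j}, f j * (if h : p j then x ⟨j, h⟩ else 0) = 0 :=
      Finset.sum_eq_zero fun j _ => by rw [dif_neg j.2, mul_zero]
    rw [h2, add_zero]
    exact Finset.sum_congr rfl fun j _ => by rw [dif_pos j.2]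
  set w : Fin n → ℝ := fun j => if h : p j then w₀ ⟨j, h⟩ else 0 with hw
  set v : Fin n → ℝ := fun j => if h : p j then v₀ ⟨j, h⟩ else 0 with hv
  have hw_out : ∀ j, ¬ p j → w j = 0 := fun j hj => dif_neg hj
  have hv_out : ∀ j, ¬ p j → v j = 0 := fun j hj => dif_neg hj
  have hkw : ∀ j, p j → (k *ᵥ w) j = 0 := fun j hj =>
    (sum_ext w₀ (fun l => k j l)).trans (congrFun hkw₀ ⟨j, hj⟩)
  have hvk : ∀ j, p j → (v ᵥ* k) j = 0 := fun j hj =>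
    (Finset.sum_congr rfl fun l _ => mul_comm _ _).trans ((sum_ext v₀ (fun l => k l j)).trans
      ((Finset.sum_congr rfl fun l _ => mul_comm _ _).trans (congrFun hvk₀ ⟨j, hj⟩)))
  have hann_up : ∀ Z ∈ bplus n, v ⬝ᵥ Z *ᵥ (k *ᵥ w) = 0 := by
    intro Z hZ
    refine Finset.sum_eq_zero fun i _ => ?_
    by_cases hi : p i
    · refine mul_eq_zero_of_right _ ?_
      change ∑ j, Z i j * (k *ᵥ w) j = 0
      refine Finset.sum_eq_zero fun j _ => ?_
      by_cases hj : p j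
      · exact mul_eq_zero_of_right _ (hkw j hj)
      · exact mul_eq_zero_of_left (hZ.2 i j (lt_of_not_ge fun hij => hj (hp i j hij hi))) _
    · exact mul_eq_zero_of_left (hv_out i hi) _
  have hann_lo : ∀ Z ∈ bminus n, (v ᵥ* k) ⬝ᵥ Z *ᵥ w = 0 := by
    intro Z hZ
    refine Finset.sum_eq_zero fun i _ => ?_
    by_cases hi : p i
    · exact mul_eq_zero_of_left (hvk i hi) _
    · refine mul_eq_zero_of_right _ ?_
      change ∑ j, Z i j * w j = 0
      refine Finset.sum_eq_zero fun j _ => ?_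
      by_cases hj : p j
      · exact mul_eq_zero_of_left (hZ.2 i j (lt_of_not_ge fun hij => hi (hp j i hij hj))) _
      · exact mul_eq_zero_of_right _ (hw_out j hj)
  have hann : ∀ Z ∈ slSub n, v ⬝ᵥ Z *ᵥ (k *ᵥ w) = 0 := by
    intro Z hZ
    rw [← ht] at hZ
    obtain ⟨S, hS, T, ⟨L, hL, rfl⟩, rfl⟩ := Submodule.mem_sup.1 hZ
    rw [Matrix.add_mulVec, dotProduct_add, hann_up S hS, zero_add, AdM_apply,
      Matrix.mulVec_mulVec, Matrix.mul_assoc, Matrix.nonsing_inv_mul _ hu, Matrix.mul_one,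
      ← Matrix.mulVec_mulVec, Matrix.dotProduct_mulVec]
    exact hann_lo L hL
  obtain ⟨b, hb⟩ := Function.ne_iff.1 hv₀
  have hvb : v b ≠ 0 := by rw [hv]; simpa [b.2] using hb
  have hkw_ne : k *ᵥ w ≠ 0 := by
    intro hz
    have hw0 : w = 0 := by
      rw [← Matrix.one_mulVec w, ← Matrix.nonsing_inv_mul _ hu, ← Matrix.mulVec_mulVec, hz,
        Matrix.mulVec_zero]
    apply hw₀
    funext j
    have := congrFun hw0 j
    rw [hw] at this
    simpa [j.2] using this
  obtain ⟨a, ha⟩ := Function.ne_iff.1 hkw_ne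
  have hba : (b : Fin n) ≠ a := by
    rintro rfl
    exact ha (hkw _ b.2)
  have := hann (Matrix.single b a 1) (mem_slSub.2 (Matrix.trace_single_eq_of_ne _ _ _ hba))
  rw [Matrix.single_mulVec_eq, one_mul, dotProduct_smul, dotProduct_single_one,
    smul_eq_mul] at this
  exact (mul_eq_zero.1 this).elim ha hvb

theorem sum_diag_eq_of_mul_eq {k a c : Mn n} (p : Fin n → Prop) [DecidablePred p]
    (hp : ∀ i j, i ≤ j → p i → p j) (hdet : (k.toBlock p p).det ≠ 0) (ha : a ∈ upTri n)
    (hc : c ∈ loTri n) (h : a * k = k * c) :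
    ∑ i : {i // p i}, a i i = ∑ i : {i // p i}, c i i := by
  have ha0 : a.toBlock p (fun i => ¬ p i) = 0 := by
    ext i j
    exact ha i j (lt_of_not_ge fun hij => j.2 (hp i j hij i.2))
  have hc0 : c.toBlock (fun i => ¬ p i) p = 0 := by
    ext i j
    exact hc i j (lt_of_not_ge fun hij => i.2 (hp j i hij j.2))
  have h1 := congrArg (fun M : Mn n => M.toBlock p p) h
  simp only [Matrix.toBlock_mul_eq_add p p p, ha0, hc0, Matrix.zero_mul, Matrix.mul_zero,
    add_zero] at h1
  have hu : IsUnit (k.toBlock p p).det := isUnit_iff_ne_zero.2 hdet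
  have h2 : (a.toBlock p p).trace = (c.toBlock p p).trace := by
    rw [← Matrix.mul_nonsing_inv_cancel_right _ (a.toBlock p p) hu, h1, Matrix.trace_mul_comm,
      Matrix.nonsing_inv_mul_cancel_left _ _ hu]
  exact h2

theorem pi0_eq_of_mul_eq {k a c : Mn n} (hk : k.det = 1)
    (ht : Transv (bplus n) ((bminus n).map (AdM k))) (ha : a ∈ upTri n) (hc : c ∈ loTri n)
    (h : a * k = k * c) : pi0 a = pi0 c := by
  change Matrix.diagonal _ = Matrix.diagonal _
  congr 1
  funext i
  have hle := sum_diag_eq_of_mul_eq (fun j => i ≤ j) (fun _ _ hxy hx => hx.trans hxy)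
    (det_toBlock_ne_zero hk ht _ fun _ _ hxy hx => hx.trans hxy) ha hc h
  have hlt := sum_diag_eq_of_mul_eq (fun j => i < j) (fun _ _ hxy hx => hx.trans_le hxy)
    (det_toBlock_ne_zero hk ht _ fun _ _ hxy hx => hx.trans_le hxy) ha hc h
  have hsplit : ∀ f : Fin n → ℝ,
      ∑ j : {j // i ≤ j}, f j = f i + ∑ j : {j // i < j}, f j := by
    intro f
    rw [← Finset.sum_subtype (Finset.Ici i) (fun _ => Finset.mem_Ici) f,
      ← Finset.sum_subtype (Finset.Ioi i) (fun _ => Finset.mem_Ioi) f,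
      ← Finset.Ioi_insert, Finset.sum_insert (by simp)]
  rw [hsplit fun j => a j j, hsplit fun j => c j j, hlt] at hle
  exact add_right_cancel hle

/-- On the intersection of two transverse parabolic subspaces, `ν*` only depends on these. -/
theorem IsStd.nustar_eq_of_mem_inter {h m : Mn n} {V₁ V₂ V₃ V₄ : Submodule ℝ (Mn n)}
    (hh : IsStd h V₁ V₄) (hm : IsStd m V₂ V₃) (ht : Transv V₁ V₃) {u : Mn n}
    (hu₁ : u ∈ V₁) (hu₃ : u ∈ V₃) : nustar h u = nustar m u := by
  obtain ⟨hd, rfl, -⟩ := hh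
  obtain ⟨md, -, rfl⟩ := hm
  have hu := isUnit_det_of_det_eq_one hd
  have mu := isUnit_det_of_det_eq_one md
  have ht' := ht.map_AdM (det_inv_eq_one hd)
  rw [← Submodule.map_comp, ← Submodule.map_comp, ← AdM_mul, ← AdM_mul,
    Matrix.nonsing_inv_mul _ hu] at ht'
  have hone : (AdM 1 : Mn n →ₗ[ℝ] Mn n) = LinearMap.id := by
    ext1 Z
    simp [AdM_apply]
  rw [hone, Submodule.map_id] at ht'
  obtain ⟨a, ha, rfl⟩ := hu₁
  obtain ⟨c, hc, hca⟩ := hu₃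
  have hk : (h⁻¹ * m).det = 1 := by rw [Matrix.det_mul, det_inv_eq_one hd, md, one_mul]
  have hac : a * (h⁻¹ * m) = (h⁻¹ * m) * c := by
    have h1 : h⁻¹ * AdM m c * m = h⁻¹ * AdM h a * m := by rw [hca]
    simp only [AdM_apply, Matrix.mul_assoc, Matrix.nonsing_inv_mul _ mu, Matrix.mul_one,
      Matrix.nonsing_inv_mul_cancel_left _ _ hu] at h1
    rw [Matrix.mul_assoc, h1]
  rw [nustar, nustar, LinearMap.comp_apply, LinearMap.comp_apply, AdM_inv_AdM hd, ← hca,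
    AdM_inv_AdM md]
  exact pi0_eq_of_mul_eq hk ht' ha.2 hc.2 hac

/-- The affine cross ratio does not depend on the choices made in its definition. -/
theorem IsCross.unique {b b' : Mn n} {A₁ A₂ A₃ A₄ : Set (Mn n)}
    {V₁ V₂ V₃ V₄ : Submodule ℝ (Mn n)} (h₁ : IsAffPara A₁ V₁) (h₂ : IsAffPara A₂ V₂)
    (h₃ : IsAffPara A₃ V₃) (h₄ : IsAffPara A₄ V₄) (t₁₃ : Transv V₁ V₃) (t₂₄ : Transv V₂ V₄)
    (hb : IsCross b A₁ A₂ A₃ A₄ V₁ V₂ V₃ V₄) (hb' : IsCross b' A₁ A₂ A₃ A₄ V₁ V₂ V₃ V₄) :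
    b = b' := by
  obtain ⟨h, m, X, Z, hh, hm, hX, hZ, rfl⟩ := hb
  obtain ⟨h', m', X', Z', hh', hm', hX', hZ', rfl⟩ := hb'
  rw [← hh.nustar_eq hh', ← hm.nustar_eq hm']
  have e₁₃ := hh.nustar_eq_of_mem_inter hm t₁₃ (h₁.sub_mem hX.1 hX'.1) (h₃.sub_mem hX.2 hX'.2)
  have e₂₄ := hm.nustar_eq_of_mem_inter hh t₂₄ (h₂.sub_mem hZ.1 hZ'.1) (h₄.sub_mem hZ.2 hZ'.2)
  simp only [map_sub] at e₁₃ e₂₄ ⊢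
  rw [sub_eq_sub_iff_add_eq_add] at e₁₃ e₂₄
  grind

end

/-- Let A₁, …, A₄ be pairwise transverse affine parabolic spaces and
(g,Y) ∈ SLₙ(ℝ) ⋉ 𝔰𝔩ₙ(ℝ). Then the images (g,Y)·Aᵢ are again pairwise transverse affine
parabolic spaces (with directions Ad(g)Vᵢ) and
β((g,Y)·A₁, …, (g,Y)·A₄) = β(A₁, …, A₄). -/
theorem affine_cross_ratio_invariant (n : ℕ) (hn : 2 ≤ n)
    (A₁ A₂ A₃ A₄ : Set (Mn n)) (V₁ V₂ V₃ V₄ : Submodule ℝ (Mn n))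
    (h₁ : IsAffPara A₁ V₁) (h₂ : IsAffPara A₂ V₂)
    (h₃ : IsAffPara A₃ V₃) (h₄ : IsAffPara A₄ V₄)
    (t₁₂ : Transv V₁ V₂) (t₁₃ : Transv V₁ V₃) (t₁₄ : Transv V₁ V₄)
    (t₂₃ : Transv V₂ V₃) (t₂₄ : Transv V₂ V₄) (t₃₄ : Transv V₃ V₄)
    (g Y : Mn n) (hg : g.det = 1) (hY : Y.trace = 0) :
    (IsAffPara (affMap g Y '' A₁) (V₁.map (AdM g)) ∧
     IsAffPara (affMap g Y '' A₂) (V₂.map (AdM g)) ∧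
     IsAffPara (affMap g Y '' A₃) (V₃.map (AdM g)) ∧
     IsAffPara (affMap g Y '' A₄) (V₄.map (AdM g))) ∧
    (Transv (V₁.map (AdM g)) (V₂.map (AdM g)) ∧ Transv (V₁.map (AdM g)) (V₃.map (AdM g)) ∧
     Transv (V₁.map (AdM g)) (V₄.map (AdM g)) ∧ Transv (V₂.map (AdM g)) (V₃.map (AdM g)) ∧
     Transv (V₂.map (AdM g)) (V₄.map (AdM g)) ∧ Transv (V₃.map (AdM g)) (V₄.map (AdM g))) ∧
    ∀ b b' : Mn n,
      IsCross b (affMap g Y '' A₁) (affMap g Y '' A₂) (affMap g Y '' A₃) (affMap g Y '' A₄)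
        (V₁.map (AdM g)) (V₂.map (AdM g)) (V₃.map (AdM g)) (V₄.map (AdM g)) →
      IsCross b' A₁ A₂ A₃ A₄ V₁ V₂ V₃ V₄ → b = b' := by
  have k₁ := h₁.image_affMap hg hY
  have k₂ := h₂.image_affMap hg hY
  have k₃ := h₃.image_affMap hg hY
  have k₄ := h₄.image_affMap hg hY
  exact ⟨⟨k₁, k₂, k₃, k₄⟩, ⟨t₁₂.map_AdM hg, t₁₃.map_AdM hg, t₁₄.map_AdM hg, t₂₃.map_AdM hg,
    t₂₄.map_AdM hg, t₃₄.map_AdM hg⟩, fun b b' hb hb' =>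
    hb.unique k₁ k₂ k₃ k₄ (t₁₃.map_AdM hg) (t₂₄.map_AdM hg) (hb'.image_affMap hg Y)⟩

end
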